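/- For every triangulation T of a convex nonagon (n = 9) and every vertex w of the nonagon, there exists a set S of at most 3 vertices with w ∈ S that dominates T. -/

import Mathlib

/-!
Combinatorial model of a triangulated convex `n`-gon.
Vertices are elements of `ZMod n` in cyclic order; polygon edges are the
unordered pairs `{i, i+1}`; diagonals are other unordered pairs; two diagonals
cross when their endpoints strictly interleave in cyclic order; a triangulation
is a set of `n - 3` pairwise non-crossing diagonals.
-/

/-- The unordered pair `e` is a polygon edge `{i, i+1}`. -/
def IsPolygonEdge (n : ℕ) (e : Finset (ZMod n)) : Prop :=
  ∃ i : ZMod n, e = {i, i + 1}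

/-- `x` lies strictly inside the open cyclic arc from `a` to `b`
(going in the positive cyclic direction). -/
def InOpenArc (n : ℕ) (a b x : ZMod n) : Prop :=
  0 < (x - a).val ∧ (x - a).val < (b - a).val

/-- Two unordered pairs cross: their endpoints strictly interleave in cyclic
order, i.e. one endpoint of the second lies strictly inside one open arc
determined by the first and the other endpoint lies strictly inside the other
open arc. -/
def Crosses (n : ℕ) (e₁ e₂ : Finset (ZMod n)) : Prop :=
  ∃ a b c d : ZMod n, e₁ = {a, b} ∧ e₂ = {c, d} ∧
    InOpenArc n a b c ∧ InOpenArc n b a d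

/-- A diagonal is an unordered pair of two distinct vertices that is not a
polygon edge. -/
def IsDiagonal (n : ℕ) (d : Finset (ZMod n)) : Prop :=
  d.card = 2 ∧ ¬ IsPolygonEdge n d

/-- A triangulation of the convex `n`-gon: a set of `n - 3` pairwise
non-crossing diagonals. -/
def IsTriangulation (n : ℕ) (T : Finset (Finset (ZMod n))) : Prop :=
  T.card = n - 3 ∧ (∀ d ∈ T, IsDiagonal n d) ∧
    ∀ d₁ ∈ T, ∀ d₂ ∈ T, d₁ ≠ d₂ → ¬ Crosses n d₁ d₂

/-- A triangle of the triangulation `T`: a 3-element set of vertices each pair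
of which is either a polygon edge or a diagonal of `T`. -/
def IsTriangleOf (n : ℕ) (T : Finset (Finset (ZMod n))) (t : Finset (ZMod n)) : Prop :=
  t.card = 3 ∧ ∀ x ∈ t, ∀ y ∈ t, x ≠ y → IsPolygonEdge n {x, y} ∨ {x, y} ∈ T

/-- A set `S` of vertices dominates `T` if every triangle of `T` contains a
vertex of `S`. -/
def VertexDominates (n : ℕ) (T : Finset (Finset (ZMod n))) (S : Finset (ZMod n)) : Prop :=
  ∀ t, IsTriangleOf n T t → ∃ v ∈ S, v ∈ t

/-- A set `H` of diagonals dominates `T` if every triangle of `T` contains an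
endpoint of some diagonal in `H`. -/
def DiagDominates (n : ℕ) (T H : Finset (Finset (ZMod n))) : Prop :=
  ∀ t, IsTriangleOf n T t → ∃ d ∈ H, ∃ v ∈ d, v ∈ t

/-- An ear of `T`: a triangle of `T` two of whose three sides are polygon
edges. -/
def IsEar (n : ℕ) (T : Finset (Finset (ZMod n))) (t : Finset (ZMod n)) : Prop :=
  IsTriangleOf n T t ∧ ∃ a b c : ZMod n, t = {a, b, c} ∧
    IsPolygonEdge n {a, b} ∧ IsPolygonEdge n {b, c}

namespace Nonagon

/-- Branching order: a diagonal, the mask of pairs compatible with it, the mask of all other pairs.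
The pair `i < j` has bit `9 * i + j`. -/
def order : List ((ℕ × ℕ) × ℕ × ℕ) := [
  ((0, 2), 2417851639229258349154303, 2417851639229258349412347),
  ((0, 7), 2417847018518414054260735, 2417851639229258349412223),
  ((1, 3), 2417851639229258219388923, 2417851639229258349408255),
  ((1, 8), 2417851639229258349412099, 2417851639229258349281279),
  ((2, 4), 2417851639229193924898807, 2417851639229258345218047),
  ((3, 5), 2417851639198472019632111, 2417851639229254054445055),
  ((4, 6), 2417851625718455163928543, 2417851639224860302901247),
  ((5, 7), 2417847027538833268768703, 2417851634725658722041855),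
  ((6, 8), 2417851634716845415530367, 2417847027543239922024447),
  ((0, 3), 2417851639229258219134975, 2417851639229258349412343),
  ((0, 6), 2417851625692019547766783, 2417851639229258349412287),
  ((1, 4), 2417851639229193799073779, 2417851639229258349404159),
  ((1, 7), 2417847018518414054391683, 2417851639229258349346815),
  ((2, 5), 2417851639198411894280167, 2417851639229258341023743),
  ((2, 8), 2417851639229258349285127, 2417851639229258282303487),
  ((3, 6), 2417851625692071175626703, 2417851639229249759477759),
  ((4, 7), 2417847018536027757166495, 2417851639220462256390143),
  ((5, 8), 2417851639216038389645119, 2417851630222059094671359),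
  ((0, 4), 2417851639229193798828031, 2417851639229258349412335),
  ((0, 5), 2417851639198411776622591, 2417851639229258349412319),
  ((1, 5), 2417851639198411776851939, 2417851639229258349395967),
  ((1, 6), 2417851625692019547963331, 2417851639229258349379583),
  ((2, 6), 2417851625692019648597959, 2417851639229258332635135),
  ((2, 7), 2417847018518414121439111, 2417851639229258315857919),
  ((3, 7), 2417847018518448451821455, 2417851639229241169543167),
  ((3, 8), 2417851639229258286374671, 2417851639229223989673983),
  ((4, 8), 2417851639229228225806111, 2417851639211666163367935)]

/-- Triples not containing vertex `0`. -/
def tris : List (ℕ × ℕ × ℕ) := [(1, 2, 3), (1, 2, 4), (1, 2, 5), (1, 2, 6), (1, 2, 7), (1, 2, 8), (1, 3, 4), (1, 3, 5), (1, 3, 6), (1, 3, 7), (1, 3, 8), (1, 4, 5), (1, 4, 6), (1, 4, 7), (1, 4, 8), (1, 5, 6), (1, 5, 7), (1, 5, 8), (1, 6, 7), (1, 6, 8), (1, 7, 8), (2, 3, 4), (2, 3, 5), (2, 3, 6), (2, 3, 7), (2, 3, 8), (2, 4, 5), (2, 4, 6), (2, 4, 7), (2, 4, 8), (2, 5, 6),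 (2, 5, 7), (2, 5, 8), (2, 6, 7), (2, 6, 8), (2, 7, 8), (3, 4, 5), (3, 4, 6), (3, 4, 7), (3, 4, 8), (3, 5, 6), (3, 5, 7), (3, 5, 8), (3, 6, 7), (3, 6, 8), (3, 7, 8), (4, 5, 6), (4, 5, 7), (4, 5, 8), (4, 6, 7), (4, 6, 8), (4, 7, 8), (5, 6, 7), (5, 6, 8), (5, 7, 8), (6, 7, 8)]

/-- Candidate pairs completing the vertex `0` to a dominating set. -/
def cands : List (ℕ × ℕ) := [(1, 2), (1, 3), (1, 4), (1, 5), (1, 6), (1, 7), (1, 8), (2, 3), (2, 4), (2, 5), (2, 6), (2, 7), (2, 8), (3, 4), (3, 5), (3, 6), (3, 7), (3, 8), (4, 5), (4, 6), (4, 7), (4, 8), (5, 6), (5, 7), (5, 8), (6, 7), (6, 8), (7, 8)]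

def present (A : ℕ) (t : ℕ × ℕ × ℕ) : Bool :=
  A.testBit (9 * t.1 + t.2.1) && (A.testBit (9 * t.2.1 + t.2.2) && A.testBit (9 * t.1 + t.2.2))

def hit (s : ℕ × ℕ) (t : ℕ × ℕ × ℕ) : Bool :=
  Nat.beq t.1 s.1 || (Nat.beq t.2.1 s.1 || (Nat.beq t.2.2 s.1 ||
    (Nat.beq t.1 s.2 || (Nat.beq t.2.1 s.2 || Nat.beq t.2.2 s.2))))

def chk (A : ℕ) : Bool :=
  cands.any fun s => tris.all fun t => hit s t || !present A t

def search : List ((ℕ × ℕ) × ℕ × ℕ) → ℕ → Bool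
  | [], A => chk A
  | d :: l, A => cond (A.testBit (9 * d.1.1 + d.1.2))
      (chk A || (search l (Nat.land A d.2.1) && search l (Nat.land A d.2.2)))
      (search l A)

set_option maxRecDepth 100000 in
theorem search_order : search order 2417851639229258349412351 = true := by
  decide +kernel

/-- Strictly interleaving pairs. -/
def Inter (i j k l : ℕ) : Prop := (i < k ∧ k < j ∧ j < l) ∨ (k < i ∧ i < l ∧ l < j)

instance (i j k l : ℕ) : Decidable (Inter i j k l) := by unfold Inter; infer_instance

theorem order_spec : ∀ d ∈ order, d.1.1 < d.1.2 ∧ d.1.2 < 9 ∧ ∀ i < 9, ∀ j < 9, i < j →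
    (d.2.1.testBit (9 * i + j) = true ∨ Inter d.1.1 d.1.2 i j) ∧
    (d.2.2.testBit (9 * i + j) = true ∨ d.1 = (i, j)) := by
  decide +kernel

theorem tris_spec (i : ℕ) (hi : i < 9) (j : ℕ) (hj : j < 9) (k : ℕ) (hk : k < 9)
    (h0 : 0 < i) (h1 : i < j) (h2 : j < k) : (i, j, k) ∈ tris := by
  have key : ∀ i j k : Fin 9, (0 < i.val ∧ i < j ∧ j < k) →
      (i.val, j.val, k.val) ∈ tris := by decide +kernel
  exact key ⟨i, hi⟩ ⟨j, hj⟩ ⟨k, hk⟩ ⟨h0, h1, h2⟩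

def Sound (Q : ℕ → ℕ → Prop) (A : ℕ) : Prop :=
  ∀ i < 9, ∀ j < 9, i < j → Q i j → A.testBit (9 * i + j) = true

def Good (Q : ℕ → ℕ → Prop) : Prop :=
  ∃ s : ℕ × ℕ, ∀ i < 9, ∀ j < 9, ∀ k < 9, 0 < i → i < j → j < k →
    Q i j → Q j k → Q i k → hit s (i, j, k) = true

theorem chk_sound (Q : ℕ → ℕ → Prop) (A : ℕ) (hA : Sound Q A) (h : chk A = true) : Good Q := by
  unfold chk at h
  rw [List.any_eq_true] at h
  obtain ⟨s, -, hs⟩ := h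
  rw [List.all_eq_true] at hs
  refine ⟨s, fun i hi j hj k hk h0 hij hjk q1 q2 q3 => ?_⟩
  have h1 := hs _ (tris_spec i hi j hj k hk h0 hij hjk)
  have h2 : present A (i, j, k) = true := by
    simp [present, hA i hi j hj hij q1, hA j hj k hk hjk q2, hA i hi k hk (hij.trans hjk) q3]
  simpa [h2] using h1

theorem search_sound (Q : ℕ → ℕ → Prop)
    (hQ : ∀ i j k l, i < 9 → j < 9 → k < 9 → l < 9 → Inter i j k l → Q i j → Q k l → False) :
    ∀ (L : List ((ℕ × ℕ) × ℕ × ℕ)), (∀ d ∈ L, d ∈ order) →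
      ∀ A, Sound Q A → search L A = true → Good Q
  | [], _, A, hA, h => chk_sound Q A hA h
  | d :: l, hL, A, hA, h => by
    have ih := search_sound Q hQ l (fun e he => hL e (List.mem_cons_of_mem _ he))
    obtain ⟨hd1, hd2, hd⟩ := order_spec d (hL d (List.mem_cons_self ..))
    rw [search] at h
    cases hb : A.testBit (9 * d.1.1 + d.1.2) with
    | false =>
      rw [hb] at h
      exact ih A hA h
    | true =>
      rw [hb] at h
      simp only [cond_true, Bool.or_eq_true, Bool.and_eq_true] at h
      rcases h with h | ⟨h1, h2⟩
      · exact chk_sound Q A hA h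
      · by_cases q : Q d.1.1 d.1.2
        · refine ih _ (fun i hi j hj hij hq => ?_) h1
          have := (hd i hi j hj hij).1
          change (A &&& d.2.1).testBit _ = true
          rw [Nat.testBit_and, hA i hi j hj hij hq]
          rcases this with h | h
          · simpa using h
          · exact (hQ _ _ _ _ (hd1.trans hd2) hd2 hi hj h q hq).elim
        · refine ih _ (fun i hi j hj hij hq => ?_) h2
          have := (hd i hi j hj hij).2
          change (A &&& d.2.2).testBit _ = true
          rw [Nat.testBit_and, hA i hi j hj hij hq]
          rcases this with h | h
          · simpa using h
          · rw [h] at q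
            exact (q hq).elim

theorem full_sound (Q : ℕ → ℕ → Prop) : Sound Q 2417851639229258349412351 := by
  have : ∀ i < 9, ∀ j < 9, i < j → Nat.testBit 2417851639229258349412351 (9 * i + j) = true := by decide +kernel
  exact fun i hi j hj hij _ => this i hi j hj hij

theorem good (Q : ℕ → ℕ → Prop)
    (hQ : ∀ i j k l, i < 9 → j < 9 → k < 9 → l < 9 → Inter i j k l → Q i j → Q k l → False) :
    Good Q :=
  search_sound Q hQ order (fun _ h => h) _ (full_sound Q) search_order

/-- Sides of the triangulated polygon, seen from `w`. -/
def Side (T : Finset (Finset (ZMod 9))) (w : ZMod 9) (i j : ℕ) : Prop :=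
  IsPolygonEdge 9 {w + (i : ZMod 9), w + (j : ZMod 9)} ∨
    ({w + (i : ZMod 9), w + (j : ZMod 9)} : Finset (ZMod 9)) ∈ T

theorem edge_iff (x y : ZMod 9) (h : IsPolygonEdge 9 {x, y}) : y = x + 1 ∨ x = y + 1 := by
  obtain ⟨i, hi⟩ := h
  have key : ∀ x y i : ZMod 9, ({x, y} : Finset (ZMod 9)) = {i, i + 1} →
      y = x + 1 ∨ x = y + 1 := by decide +kernel
  exact key x y i hi

theorem edge_no_inter (i : ℕ) (hi : i < 9) (j : ℕ) (hj : j < 9) (k : ℕ) (hk : k < 9) (l : ℕ) (hl : l < 9)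
    (h_0 : Inter i j k l) :
    ¬ ((j : ZMod 9) = (i : ZMod 9) + 1 ∨ (i : ZMod 9) = (j : ZMod 9) + 1) := by
  have key : ∀ i j k l : Fin 9, (Inter i.val j.val k.val l.val) →
      ¬ (((j.val : ℕ) : ZMod 9) = ((i.val : ℕ) : ZMod 9) + 1 ∨ ((i.val : ℕ) : ZMod 9) = ((j.val : ℕ) : ZMod 9) + 1) := by decide +kernel
  exact key ⟨i, hi⟩ ⟨j, hj⟩ ⟨k, hk⟩ ⟨l, hl⟩ h_0

theorem arcs (i : ℕ) (hi : i < 9) (j : ℕ) (hj : j < 9) (k : ℕ) (hk : k < 9)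
    (h_0 : i < k) (h_1 : k < j) :
    0 < ((k : ZMod 9) - (i : ZMod 9)).val ∧
      ((k : ZMod 9) - (i : ZMod 9)).val < ((j : ZMod 9) - (i : ZMod 9)).val := by
  have key : ∀ i j k : Fin 9, (i.val < k.val ∧ k.val < j.val) →
      0 < (((k.val : ℕ) : ZMod 9) - ((i.val : ℕ) : ZMod 9)).val ∧
      (((k.val : ℕ) : ZMod 9) - ((i.val : ℕ) : ZMod 9)).val < (((j.val : ℕ) : ZMod 9) - ((i.val : ℕ) : ZMod 9)).val := by decide +kernel
  exact key ⟨i, hi⟩ ⟨j, hj⟩ ⟨k, hk⟩ ⟨h_0, h_1⟩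

theorem arcs' (i : ℕ) (hi : i < 9) (j : ℕ) (hj : j < 9) (l : ℕ) (hl : l < 9)
    (h_0 : i < j) (h_1 : j < l) :
    0 < ((l : ZMod 9) - (j : ZMod 9)).val ∧
      ((l : ZMod 9) - (j : ZMod 9)).val < ((i : ZMod 9) - (j : ZMod 9)).val := by
  have key : ∀ i j l : Fin 9, (i.val < j.val ∧ j.val < l.val) →
      0 < (((l.val : ℕ) : ZMod 9) - ((j.val : ℕ) : ZMod 9)).val ∧
      (((l.val : ℕ) : ZMod 9) - ((j.val : ℕ) : ZMod 9)).val < (((i.val : ℕ) : ZMod 9) - ((j.val : ℕ) : ZMod 9)).val := by decide +kernel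
  exact key ⟨i, hi⟩ ⟨j, hj⟩ ⟨l, hl⟩ ⟨h_0, h_1⟩

theorem pair_ne (i : ℕ) (hi : i < 9) (j : ℕ) (hj : j < 9) (k : ℕ) (hk : k < 9)
    (h_0 : i < k) (h_1 : k < j) :
    (k : ZMod 9) ≠ (i : ZMod 9) ∧ (k : ZMod 9) ≠ (j : ZMod 9) := by
  have key : ∀ i j k : Fin 9, (i.val < k.val ∧ k.val < j.val) →
      ((k.val : ℕ) : ZMod 9) ≠ ((i.val : ℕ) : ZMod 9) ∧ ((k.val : ℕ) : ZMod 9) ≠ ((j.val : ℕ) : ZMod 9) := by decide +kernel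
  exact key ⟨i, hi⟩ ⟨j, hj⟩ ⟨k, hk⟩ ⟨h_0, h_1⟩

theorem side_edge (w : ZMod 9) (i j k l : ℕ) (hi : i < 9) (hj : j < 9) (hk : k < 9) (hl : l < 9)
    (h : Inter i j k l) : ¬ IsPolygonEdge 9 {w + (i : ZMod 9), w + (j : ZMod 9)} := by
  intro he
  apply edge_no_inter i hi j hj k hk l hl h
  rcases edge_iff _ _ he with h | h
  · exact Or.inl (add_left_cancel (h.trans (add_assoc _ _ _)))
  · exact Or.inr (add_left_cancel (h.trans (add_assoc _ _ _)))

theorem side_cross (T : Finset (Finset (ZMod 9))) (hT : IsTriangulation 9 T) (w : ZMod 9)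
    (i j k l : ℕ) (hi : i < 9) (hj : j < 9) (hk : k < 9) (hl : l < 9)
    (h1 : i < k) (h2 : k < j) (h3 : j < l)
    (hp : ({w + (i : ZMod 9), w + (j : ZMod 9)} : Finset (ZMod 9)) ∈ T)
    (hq : ({w + (k : ZMod 9), w + (l : ZMod 9)} : Finset (ZMod 9)) ∈ T) : False := by
  refine hT.2.2 _ hp _ hq ?_ ⟨_, _, _, _, rfl, rfl, ?_, ?_⟩
  · intro he
    have hm : w + (k : ZMod 9) ∈ ({w + (i : ZMod 9), w + (j : ZMod 9)} : Finset (ZMod 9)) := by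
      rw [he]; simp
    have hn := pair_ne i hi j hj k hk h1 h2
    rw [Finset.mem_insert, Finset.mem_singleton] at hm
    rcases hm with hm | hm
    · exact hn.1 (add_left_cancel hm)
    · exact hn.2 (add_left_cancel hm)
  · unfold InOpenArc
    rw [add_sub_add_left_eq_sub, add_sub_add_left_eq_sub]
    exact arcs i hi j hj k hk h1 h2
  · unfold InOpenArc
    rw [add_sub_add_left_eq_sub, add_sub_add_left_eq_sub]
    exact arcs' i hi j hj l hl (h1.trans h2) h3

theorem side_noncrossing (T : Finset (Finset (ZMod 9))) (hT : IsTriangulation 9 T) (w : ZMod 9) :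
    ∀ i j k l, i < 9 → j < 9 → k < 9 → l < 9 → Inter i j k l →
      Side T w i j → Side T w k l → False := by
  intro i j k l hi hj hk hl h hp hq
  have h' : Inter k l i j := by unfold Inter at *; omega
  have hp := hp.resolve_left (side_edge w i j k l hi hj hk hl h)
  have hq := hq.resolve_left (side_edge w k l i j hk hl hi hj h')
  rcases h with ⟨h1, h2, h3⟩ | ⟨h1, h2, h3⟩
  · exact side_cross T hT w i j k l hi hj hk hl h1 h2 h3 hp hq
  · exact side_cross T hT w k l i j hk hl hi hj h1 h2 h3 hq hp

/-- Three elements of a 3-element set, in the order seen from `w`. -/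
theorem sorted_triple (w : ZMod 9) (t : Finset (ZMod 9)) (ht : t.card = 3) :
    ∃ i j k : ℕ, i < j ∧ j < k ∧ k < 9 ∧
      w + (i : ZMod 9) ∈ t ∧ w + (j : ZMod 9) ∈ t ∧ w + (k : ZMod 9) ∈ t := by
  let f : ZMod 9 → ℕ := fun x => (x - w).val
  have hf : Function.Injective f := fun x y h => by
    simpa using ZMod.val_injective 9 h
  have hc : (t.image f).card = 3 := by rw [Finset.card_image_of_injective _ hf, ht]
  let e := (t.image f).orderEmbOfFin hc
  have he : ∀ m, e m < 9 ∧ w + ((e m : ℕ) : ZMod 9) ∈ t := by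
    intro m
    obtain ⟨x, hx, hxe⟩ := Finset.mem_image.1 ((t.image f).orderEmbOfFin_mem hc m)
    change f x = e m at hxe
    rw [← hxe]
    refine ⟨ZMod.val_lt _, ?_⟩
    change w + (((x - w).val : ℕ) : ZMod 9) ∈ t
    rw [ZMod.natCast_zmod_val]
    simpa using hx
  exact ⟨e 0, e 1, e 2, e.strictMono (by decide), e.strictMono (by decide), (he 2).1,
    (he 0).2, (he 1).2, (he 2).2⟩

theorem cast_ne (j : ℕ) (hj : j < 9) (i : ℕ) (hi : i < 9)
    (h_0 : i < j) :
    (i : ZMod 9) ≠ (j : ZMod 9) := by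
  have key : ∀ j i : Fin 9, (i.val < j.val) →
      ((i.val : ℕ) : ZMod 9) ≠ ((j.val : ℕ) : ZMod 9) := by decide +kernel
  exact key ⟨j, hj⟩ ⟨i, hi⟩ h_0

end Nonagon

open Nonagon
/-- For every triangulation `T` of a convex nonagon and every vertex `w` of
the nonagon, there is a dominating set of at most three vertices containing
`w`. -/
theorem nonagon_dominating_with_vertex (T : Finset (Finset (ZMod 9)))
    (hT : IsTriangulation 9 T) (w : ZMod 9) :
    ∃ S : Finset (ZMod 9), S.card ≤ 3 ∧ w ∈ S ∧ VertexDominates 9 T S := by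
  
  obtain ⟨⟨a, b⟩, hs⟩ := good (Side T w) (side_noncrossing T hT w)
  refine ⟨{w, w + (a : ZMod 9), w + (b : ZMod 9)}, Finset.card_le_three, by simp, ?_⟩
  intro t ht
  obtain ⟨i, j, k, hij, hjk, hk, ti, tj, tk⟩ := sorted_triple w t ht.1
  rcases Nat.eq_zero_or_pos i with h0 | h0
  · subst h0
    exact ⟨w, by simp, by simpa using ti⟩
  · have side : ∀ p q : ℕ, p < q → q < 9 → w + (p : ZMod 9) ∈ t → w + (q : ZMod 9) ∈ t →
        Side T w p q := fun p q hpq hq hp' hq' =>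
      ht.2 _ hp' _ hq' fun h => cast_ne q hq p (hpq.trans hq) hpq (add_left_cancel h)
    have h := hs i (by omega) j (by omega) k hk h0 hij hjk (side i j hij (by omega) ti tj)
      (side j k hjk hk tj tk) (side i k (hij.trans hjk) hk ti tk)
    simp only [hit, Bool.or_eq_true, Nat.beq_eq] at h
    rcases h with h | h | h | h | h | h
    · exact ⟨w + (a : ZMod 9), by simp, h ▸ ti⟩
    · exact ⟨w + (a : ZMod 9), by simp, h ▸ tj⟩
    · exact ⟨w + (a : ZMod 9), by simp, h ▸ tk⟩
    · exact ⟨w + (b : ZMod 9), by simp, h ▸ ti⟩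
    · exact ⟨w + (b : ZMod 9), by simp, h ▸ tj⟩
    · exact ⟨w + (b : ZMod 9), by simp, h ▸ tk⟩
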